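/- arXiv:2208.00303 — 2 statements merged into one kernel-verified Lean document; each statement's English description precedes it below -/
import Mathlib

section
/- Extend the definition of the matrices C_{ij} to all 1 ≤ i, j ≤ p by setting C_{ij} = C_{ji}^t when i > j. Then for all integers i, j with 2 ≤ i, j ≤ p: C_{ij} − q·C_{i−1,j} − q·C_{i,j−1} + q²·C_{i−1,j−1} = (1 − q²)·q^{|i−j|}·J^{(i−j) mod n}. -/
open Matrix

noncomputable section

/-- The indeterminate `q` of `ℤ[q]`. -/
def q : Polynomial ℤ := Polynomial.X

/-- The `n × n` cyclic shift permutation matrix `J = C(0,1,0,…,0)` over `ℤ[q]`: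
the `(r,c)` entry is `1` iff `c ≡ r + 1 (mod n)`.  It satisfies `J^n = I` and
`Jᵀ = J^(n-1)`. -/
def Jmat (n : ℕ) : Matrix (Fin n) (Fin n) (Polynomial ℤ) :=
  Matrix.of fun r c => if (c : ℕ) = ((r : ℕ) + 1) % n then 1 else 0

/-- The `n × n` exchange matrix `K`: in `1`-based indexing the `(r,c)` entry is `1`
iff `r + c = n + 1`. -/
def Kmat (n : ℕ) : Matrix (Fin n) (Fin n) (Polynomial ℤ) :=
  Matrix.of fun r c => if (r : ℕ) + (c : ℕ) + 1 = n then 1 else 0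

/-- The `0`-indexed `m`-th entry of the first row of the circulant matrix `C_{ij}`:
the first row consists, in order, of the `i` entries `q^(j-i), q^(j-i+2), …, q^(j+i-2)`,
then `n+1-i-j` entries `q^(i+j)`, then the `i-1` entries `q^(j+i-2), …, q^(j-i+2)`,
then `j-i` entries `q^(j-i)`. -/
def firstRow (n i j m : ℕ) : Polynomial ℤ :=
  if m < i then q ^ (j - i + 2 * m)
  else if m + j < n + 1 then q ^ (i + j)
  else if m + j < n + i then q ^ (i + j - 2 * (m + j - n))
  else q ^ (j - i)

/-- The circulant matrix `C_{ij}` (for `1 ≤ i ≤ j ≤ p`): its `(r,c)` entry is the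
`((c - r) mod n)`-th (`0`-indexed) entry of its first row. -/
def Cmat (n i j : ℕ) : Matrix (Fin n) (Fin n) (Polynomial ℤ) :=
  Matrix.of fun r c => firstRow n i j ((c - r : Fin n) : ℕ)

/-- `C_{ij}` extended to all `1 ≤ i, j ≤ p` by `C_{ij} = C_{ji}ᵀ` for `i > j`. -/
def Cfull (n i j : ℕ) : Matrix (Fin n) (Fin n) (Polynomial ℤ) :=
  if i ≤ j then Cmat n i j else (Cmat n j i)ᵀ

/-- Exponent of the first row entries. -/
def rowExp (n i j m : ℕ) : ℕ :=
  if m < i then j - i + 2 * m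
  else if m + j < n + 1 then i + j
  else if m + j < n + i then i + j - 2 * (m + j - n)
  else j - i

lemma firstRow_eq (n i j m : ℕ) : firstRow n i j m = q ^ rowExp n i j m := by
  unfold firstRow rowExp
  split_ifs <;> rfl

/-- Exponents of the extended family, with `m` the column-minus-row difference and
`m'` its negative modulo `n`. -/
def fullExp (n i j m m' : ℕ) : ℕ := if i ≤ j then rowExp n i j m else rowExp n j i m'

lemma Cfull_apply (n i j : ℕ) (r c : Fin n) :
    Cfull n i j r c = q ^ fullExp n i j ((c - r : Fin n) : ℕ) ((r - c : Fin n) : ℕ) := by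
  unfold Cfull fullExp
  split_ifs <;> simp [Cmat, firstRow_eq]

lemma Jmat_pow_apply (n k : ℕ) (r c : Fin n) :
    (Jmat n ^ k) r c = if (c : ℕ) = ((r : ℕ) + k) % n then 1 else 0 := by
  have hn : 0 < n := r.pos
  induction k generalizing c with
  | zero =>
    rw [pow_zero, Matrix.one_apply, Nat.add_zero, Nat.mod_eq_of_lt r.isLt]
    simp only [Fin.ext_iff, eq_comm]
  | succ k ih =>
    rw [pow_succ, Matrix.mul_apply,
      Finset.sum_eq_single (⟨((r : ℕ) + k) % n, Nat.mod_lt _ hn⟩ : Fin n)]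
    · rw [ih]
      simp [Jmat, Nat.add_assoc]
    · intro b _ hb
      rw [ih, if_neg, zero_mul]
      intro h
      exact hb (Fin.ext h)
    · simp

/-- The combinatorial heart: cancellation pattern of the four exponents. -/
lemma exp_off_lt (n i j m : ℕ) (hi : 2 ≤ i) (hij : i < j) (hjp : 2 * j ≤ n + 1)
    (hm : m < n) (h : m + (j - i) ≠ n) :
    (rowExp n i j m = rowExp n (i - 1) j m + 1 ∧
      rowExp n i (j - 1) m + 1 = rowExp n (i - 1) (j - 1) m + 2) ∨
    (rowExp n i j m = rowExp n i (j - 1) m + 1 ∧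
      rowExp n (i - 1) j m + 1 = rowExp n (i - 1) (j - 1) m + 2) := by
  unfold rowExp
  split_ifs <;> omega

lemma exp_on_lt (n i j m : ℕ) (hi : 2 ≤ i) (hij : i < j) (hjp : 2 * j ≤ n + 1)
    (hm : m < n) (h : m + (j - i) = n) :
    rowExp n i j m = j - i ∧
    ((rowExp n (i - 1) j m + 1 = j - i + 2 ∧
      rowExp n i (j - 1) m + 1 = rowExp n (i - 1) (j - 1) m + 2) ∨
    (rowExp n i (j - 1) m + 1 = j - i + 2 ∧
      rowExp n (i - 1) j m + 1 = rowExp n (i - 1) (j - 1) m + 2)) := by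
  unfold rowExp
  split_ifs <;> omega

lemma exp_off_eq (n i m m' : ℕ) (hi : 2 ≤ i) (hjp : 2 * i ≤ n + 1)
    (hm : m < n) (h : m ≠ 0) (hm' : m + m' = n) :
    (rowExp n i i m = rowExp n (i - 1) i m + 1 ∧
      rowExp n (i - 1) i m' + 1 = rowExp n (i - 1) (i - 1) m + 2) ∨
    (rowExp n i i m = rowExp n (i - 1) i m' + 1 ∧
      rowExp n (i - 1) i m + 1 = rowExp n (i - 1) (i - 1) m + 2) := by
  unfold rowExp
  split_ifs <;> omega

lemma exp_on_eq (n i : ℕ) (hi : 2 ≤ i) :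
    rowExp n i i 0 = 0 ∧ rowExp n (i - 1) i 0 = 1 ∧ rowExp n (i - 1) (i - 1) 0 = 0 := by
  unfold rowExp
  split_ifs <;> omega

lemma poly_off {a b c d : ℕ} (h : (a = b + 1 ∧ c + 1 = d + 2) ∨ (a = c + 1 ∧ b + 1 = d + 2)) :
    q ^ a - q * q ^ b - q * q ^ c + q ^ 2 * q ^ d = 0 := by
  rcases h with ⟨h1, h2⟩ | ⟨h1, h2⟩
  · obtain rfl : c = d + 1 := by omega
    subst h1; ring
  · obtain rfl : b = d + 1 := by omega
    subst h1; ring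

lemma poly_on {a b c d e : ℕ} (h0 : a = e)
    (h : (b + 1 = e + 2 ∧ c + 1 = d + 2) ∨ (c + 1 = e + 2 ∧ b + 1 = d + 2)) :
    q ^ a - q * q ^ b - q * q ^ c + q ^ 2 * q ^ d = (1 - q ^ 2) * q ^ e := by
  subst h0
  rcases h with ⟨h1, h2⟩ | ⟨h1, h2⟩
  · obtain rfl : c = d + 1 := by omega
    obtain rfl : b = a + 1 := by omega
    ring
  · obtain rfl : b = d + 1 := by omega
    obtain rfl : c = a + 1 := by omega
    ring

/-- `(c - r).val` in elementary terms. -/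
lemma sub_val_cases (n : ℕ) (r c : Fin n) :
    ((r : ℕ) ≤ c ∧ ((c - r : Fin n) : ℕ) = c - r) ∨
    ((c : ℕ) < r ∧ ((c - r : Fin n) : ℕ) = n + c - r) := by
  have hr := r.isLt
  have hc := c.isLt
  rcases Nat.lt_or_ge (c : ℕ) r with h | h
  · right
    refine ⟨h, ?_⟩
    rw [Fin.sub_def]
    simp only
    rw [Nat.mod_eq_of_lt (by omega)]
    omega
  · left
    refine ⟨h, ?_⟩
    rw [Fin.sub_def]
    simp only
    rw [show n - (r : ℕ) + c = (c - r) + n by omega, Nat.add_mod_right,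
      Nat.mod_eq_of_lt (by omega)]

lemma rowExp_diag (n i m m' : ℕ) (hi : 2 ≤ i) (hip : 2 * i ≤ n + 1) (hm : m < n)
    (hm' : m' < n) (h : (m = 0 ∧ m' = 0) ∨ m + m' = n) :
    rowExp n i i m = rowExp n i i m' := by
  unfold rowExp
  split_ifs <;> omega

/-- Equation (3.13): for `2 ≤ i, j ≤ p = ⌊(n+1)/2⌋`,
`C_{ij} - q C_{i-1,j} - q C_{i,j-1} + q² C_{i-1,j-1} = (1-q²) q^|i-j| J^((i-j) mod n)`. -/
theorem Cij_double_reduction (n : ℕ) (hn : 3 ≤ n) (i j : ℕ)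
    (hi : 2 ≤ i) (hj : 2 ≤ j) (hip : i ≤ (n + 1) / 2) (hjp : j ≤ (n + 1) / 2) :
    Cfull n i j - q • Cfull n (i - 1) j - q • Cfull n i (j - 1)
        + q ^ 2 • Cfull n (i - 1) (j - 1) =
      ((1 - q ^ 2) * q ^ ((i : ℤ) - (j : ℤ)).natAbs) •
        (Jmat n) ^ ((((i : ℤ) - (j : ℤ)) % (n : ℤ)).toNat) := by
  ext1 r c
  have hr := r.isLt
  have hc := c.isLt
  simp only [Matrix.add_apply, Matrix.sub_apply, Matrix.smul_apply, smul_eq_mul,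
    Cfull_apply, Jmat_pow_apply]
  have h1 := sub_val_cases n r c
  have h2 := sub_val_cases n c r
  generalize ((c - r : Fin n) : ℕ) = m at *
  generalize ((r - c : Fin n) : ℕ) = m' at *
  have hm : m < n := by omega
  have hm' : m' < n := by omega
  have hmm : (m = 0 ∧ m' = 0) ∨ m + m' = n := by omega
  have hcr : (c : ℕ) = ((r : ℕ) + m) % n := by
    rcases h1 with ⟨h, h'⟩ | ⟨h, h'⟩
    · rw [Nat.mod_eq_of_lt (by omega)]; omega
    · rw [show (r : ℕ) + m = c + n by omega, Nat.add_mod_right, Nat.mod_eq_of_lt hc]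
  obtain ⟨k, hk, hkn, hkc⟩ : ∃ k : ℕ, (((i : ℤ) - (j : ℤ)) % (n : ℤ)).toNat = k ∧ k < n ∧
      ((j ≤ i ∧ k = i - j) ∨ (i < j ∧ k + (j - i) = n)) := by
    rcases Nat.lt_or_ge i j with h | h
    · refine ⟨n - (j - i), ?_, by omega, by omega⟩
      rw [← Int.add_emod_right, Int.emod_eq_of_lt (by omega) (by omega)]
      omega
    · refine ⟨i - j, ?_, by omega, by omega⟩
      rw [Int.emod_eq_of_lt (by omega) (by omega)]
      omega
  rw [hk]
  have hiff : ((c : ℕ) = ((r : ℕ) + k) % n) ↔ m = k := by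
    constructor
    · intro h
      have h3 : (r : ℕ) + m ≡ r + k [MOD n] := hcr.symm.trans h
      have h4 := Nat.ModEq.add_left_cancel' _ h3
      exact Nat.ModEq.eq_of_lt_of_lt h4 hm hkn
    · rintro rfl
      exact hcr
  simp only [hiff]
  rcases lt_trichotomy i j with hij | hij | hij
  · have e1 : fullExp n i j m m' = rowExp n i j m := if_pos (by omega)
    have e2 : fullExp n (i - 1) j m m' = rowExp n (i - 1) j m := if_pos (by omega)
    have e3 : fullExp n i (j - 1) m m' = rowExp n i (j - 1) m := if_pos (by omega)
    have e4 : fullExp n (i - 1) (j - 1) m m' = rowExp n (i - 1) (j - 1) m := if_pos (by omega)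
    rw [e1, e2, e3, e4, show ((i : ℤ) - (j : ℤ)).natAbs = j - i by omega]
    split_ifs with h
    · rw [mul_one]
      obtain ⟨ha, hb⟩ := exp_on_lt n i j m hi hij (by omega) hm (by omega)
      exact poly_on ha hb
    · rw [mul_zero]
      exact poly_off (exp_off_lt n i j m hi hij (by omega) hm (by omega))
  · subst hij
    have e1 : fullExp n i i m m' = rowExp n i i m := if_pos (by omega)
    have e2 : fullExp n (i - 1) i m m' = rowExp n (i - 1) i m := if_pos (by omega)
    have e3 : fullExp n i (i - 1) m m' = rowExp n (i - 1) i m' := if_neg (by omega)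
    have e4 : fullExp n (i - 1) (i - 1) m m' = rowExp n (i - 1) (i - 1) m := if_pos (by omega)
    rw [e1, e2, e3, e4, show ((i : ℤ) - (i : ℤ)).natAbs = 0 by omega]
    split_ifs with h
    · obtain rfl : m = 0 := by omega
      obtain rfl : m' = 0 := by omega
      obtain ⟨ha, hb, hd⟩ := exp_on_eq n i hi
      rw [mul_one, ha, hb, hd]
      ring
    · rw [mul_zero]
      exact poly_off (exp_off_eq n i m m' hi (by omega) hm (by omega) (by omega))
  · have e1 : fullExp n i j m m' = rowExp n j i m' := if_neg (by omega)
    have e2 : fullExp n (i - 1) j m m' = rowExp n j (i - 1) m' := by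
      unfold fullExp
      split_ifs with h
      · rw [show i - 1 = j by omega]
        exact rowExp_diag n j m m' (by omega) (by omega) hm hm' hmm
      · rfl
    have e3 : fullExp n i (j - 1) m m' = rowExp n (j - 1) i m' := if_neg (by omega)
    have e4 : fullExp n (i - 1) (j - 1) m m' = rowExp n (j - 1) (i - 1) m' := if_neg (by omega)
    rw [e1, e2, e3, e4, show ((i : ℤ) - (j : ℤ)).natAbs = i - j by omega]
    split_ifs with h
    · rw [mul_one]
      obtain ⟨ha, hb⟩ := exp_on_lt n j i m' hj hij (by omega) hm' (by omega)
      exact poly_on ha hb.symm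
    · rw [mul_zero]
      exact poly_off (exp_off_lt n j i m' hj hij (by omega) hm' (by omega)).symm
end
end

section
/- The following identities of n×n matrices over ℤ[q] hold. (a) For all integers i, j with 2 ≤ i ≤ j ≤ p: q·J^{i−1}·K·C_{ij} − q²·J^{i−2}·K·C_{i−1,j} = q^{j−i+1}·(1 − q²)·J^{j−1}·( Σ_{k=0}^{j−i} (J^t)^k + Σ_{m=1}^{i−1} q^{2m} J^m )·K. (b) For all integers j with 1 ≤ j ≤ p: q·K·C_{1j} − q^{j+2}·E = q^{j}·(1 − q²)·( Σ_{k=0}^{j−1} J^k )·K, where E denotes the n×n all-ones matrix. -/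
open Matrix

noncomputable section

lemma aux_J_pow (n : ℕ) (k : ℕ) (r c : Fin n) :
    ((Jmat n) ^ k) r c = if (c : ℕ) = ((r : ℕ) + k) % n then 1 else 0 := by
  have hn : 0 < n := r.pos
  induction k generalizing c with
  | zero =>
    simp [Matrix.one_apply, Nat.mod_eq_of_lt r.2, Fin.ext_iff, eq_comm]
  | succ k ih =>
    rw [pow_succ, Matrix.mul_apply,
      Finset.sum_eq_single (⟨((r : ℕ) + k) % n, Nat.mod_lt _ hn⟩ : Fin n)]
    · rw [ih]
      simp [Jmat, Nat.mod_add_mod, add_assoc]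
    · intro b _ hb
      rw [ih, if_neg, zero_mul]
      intro h
      exact hb (Fin.ext h)
    · simp

lemma aux_J_mul (n : ℕ) (k : ℕ) (M : Matrix (Fin n) (Fin n) (Polynomial ℤ)) (r c : Fin n) :
    ((Jmat n) ^ k * M) r c = M ⟨((r : ℕ) + k) % n, Nat.mod_lt _ r.pos⟩ c := by
  rw [Matrix.mul_apply,
      Finset.sum_eq_single (⟨((r : ℕ) + k) % n, Nat.mod_lt _ r.pos⟩ : Fin n)]
  · rw [aux_J_pow]; simp
  · intro b _ hb
    rw [aux_J_pow, if_neg, zero_mul]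
    intro h
    exact hb (Fin.ext h)
  · simp

lemma aux_K_mul (n : ℕ) (M : Matrix (Fin n) (Fin n) (Polynomial ℤ)) (r c : Fin n) :
    (Kmat n * M) r c = M (Fin.rev r) c := by
  rw [Matrix.mul_apply, Finset.sum_eq_single (Fin.rev r)]
  · have : (r : ℕ) + (n - (r + 1)) + 1 = n := by omega
    simp [Kmat, Fin.val_rev, this]
  · intro b _ hb
    have : ¬ ((r : ℕ) + b + 1 = n) := by
      intro h
      apply hb
      ext
      rw [Fin.val_rev]
      omega
    simp [Kmat, this]
  · simp

lemma aux_JKC (n k i j : ℕ) (r c : Fin n) :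
    ((Jmat n) ^ k * (Kmat n * Cmat n i j)) r c
      = firstRow n i j (((r : ℕ) + c + (k + 1)) % n) := by
  rw [aux_J_mul, aux_K_mul]
  simp only [Cmat, Matrix.of_apply, Fin.sub_def, Fin.val_rev]
  congr 1
  have h := Nat.mod_lt ((r : ℕ) + k) r.pos
  have : n - (n - (((r : ℕ) + k) % n + 1)) + (c : ℕ) = ((r : ℕ) + k) % n + (c + 1) := by omega
  rw [this, Nat.mod_add_mod]
  congr 1
  ring

lemma aux_JK (n k : ℕ) (r c : Fin n) :
    ((Jmat n) ^ k * Kmat n) r c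
      = if ((r : ℕ) + c + (k + 1)) % n = 0 then 1 else 0 := by
  rw [aux_J_mul]
  simp only [Kmat, Matrix.of_apply]
  congr 1
  have h := Nat.mod_lt ((r : ℕ) + k) r.pos
  have e : (r : ℕ) + c + (k + 1) = (r + k) + (c + 1) := by ring
  rw [e, ← Nat.mod_add_mod ((r : ℕ) + k) n (c + 1)]
  generalize ((r : ℕ) + k) % n = x at *
  have hc := c.2
  rw [← Nat.dvd_iff_mod_eq_zero]
  apply propext
  constructor
  · intro h; exact ⟨1, by omega⟩
  · rintro ⟨d, hd⟩
    have : d = 1 := by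
      have h1 : d < 2 := by
        by_contra h2
        have : n * 2 ≤ n * d := Nat.mul_le_mul_left _ (by omega)
        omega
      have h0 : d ≠ 0 := by rintro rfl; omega
      omega
    subst this; omega

lemma aux_J_JT (n k l : ℕ) (h : k ≤ l) :
    (Jmat n) ^ l * ((Jmat n)ᵀ) ^ k = (Jmat n) ^ (l - k) := by
  have h1 : (Jmat n) * (Jmat n)ᵀ = 1 := by
    ext1 r c
    have := aux_J_mul n 1 ((Jmat n)ᵀ) r c
    rw [pow_one] at this
    rw [this]
    simp only [Jmat, Matrix.transpose_apply, Matrix.of_apply, Matrix.one_apply]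
    congr 1
    apply propext
    have hr := r.2
    have hc := c.2
    constructor
    · intro h
      have : (r : ℕ) ≡ c [MOD n] := Nat.ModEq.add_right_cancel' 1 h
      exact Fin.ext (Nat.ModEq.eq_of_lt_of_lt this hr hc)
    · rintro rfl; rfl
  induction k with
  | zero => simp
  | succ k ih =>
    rw [pow_succ, ← mul_assoc, ih (by omega)]
    obtain ⟨d, rfl⟩ : ∃ d, l = k + 1 + d := ⟨l - (k + 1), by omega⟩
    rw [show k + 1 + d - k = d + 1 by omega, show k + 1 + d - (k + 1) = d by omega,
      pow_succ, mul_assoc, h1, mul_one]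

lemma aux_mod (n t b : ℕ) (ht : t < n) (hb : b < n) :
    (t + b) % n = 0 ↔ (t + b = 0 ∨ t + b = n) := by
  rw [← Nat.dvd_iff_mod_eq_zero]
  constructor
  · rintro ⟨d, hd⟩
    have h1 : d < 2 := by
      by_contra h2
      have : n * 2 ≤ n * d := Nat.mul_le_mul_left _ (by omega)
      omega
    interval_cases d <;> omega
  · rintro (h | h) <;> simp [h]

/-- Equation (3.27): (a) for `2 ≤ i ≤ j ≤ p`,
`q J^(i-1) K C_{ij} - q² J^(i-2) K C_{i-1,j}
  = q^(j-i+1) (1-q²) J^(j-1) ( Σ_{k=0}^{j-i} (Jᵀ)^k + Σ_{m=1}^{i-1} q^(2m) J^m ) K`;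
(b) for `1 ≤ j ≤ p`,
`q K C_{1j} - q^(j+2) E = q^j (1-q²) ( Σ_{k=0}^{j-1} J^k ) K`,
where `E` is the all-ones matrix. -/
theorem dihedral_block_reduction (n : ℕ) (hn : 3 ≤ n) :
    (∀ i j : ℕ, 2 ≤ i → i ≤ j → j ≤ (n + 1) / 2 →
      q • ((Jmat n) ^ (i - 1) * Kmat n * Cmat n i j) -
          q ^ 2 • ((Jmat n) ^ (i - 2) * Kmat n * Cmat n (i - 1) j) =
        (q ^ (j - i + 1) * (1 - q ^ 2)) •
          ((Jmat n) ^ (j - 1) *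
            ((∑ k ∈ Finset.range (j - i + 1), ((Jmat n)ᵀ) ^ k) +
              ∑ m ∈ Finset.Icc 1 (i - 1), q ^ (2 * m) • (Jmat n) ^ m) * Kmat n)) ∧
    (∀ j : ℕ, 1 ≤ j → j ≤ (n + 1) / 2 →
      q • (Kmat n * Cmat n 1 j) -
          q ^ (j + 2) • (Matrix.of fun _ _ => (1 : Polynomial ℤ)) =
        (q ^ j * (1 - q ^ 2)) • ((∑ k ∈ Finset.range j, (Jmat n) ^ k) * Kmat n)) := by
  have hn0 : 0 < n := by omega
  constructor
  · intro i j hi hij hj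
    obtain ⟨a, rfl⟩ : ∃ a, i = a + 2 := ⟨i - 2, by omega⟩
    obtain ⟨b, rfl⟩ : ∃ b, j = a + 2 + b := ⟨j - (a + 2), by omega⟩
    have hnb : 2 * (a + 2 + b) ≤ n + 1 := by omega
    ext1 r c
    rw [mul_assoc, mul_assoc, Matrix.mul_add, Matrix.add_mul, Finset.mul_sum, Finset.mul_sum,
      Finset.sum_mul, Finset.sum_mul]
    simp only [Matrix.sub_apply, Matrix.smul_apply, Matrix.add_apply, Matrix.sum_apply,
      smul_eq_mul, aux_JKC, mul_smul_comm, smul_mul_assoc, ← pow_add, aux_JK]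
    obtain ⟨t, ht⟩ : ∃ t, t = ((r : ℕ) + c + (a + 2)) % n := ⟨_, rfl⟩
    have htn : t < n := ht ▸ Nat.mod_lt _ hn0
    have hu : ((r : ℕ) + c + (a + 1)) % n = if t = 0 then n - 1 else t - 1 := by
      have h1 : t = (((r : ℕ) + c + (a + 1)) % n + 1) % n := by
        rw [ht, Nat.mod_add_mod]; rfl
      have h2 := Nat.mod_lt ((r : ℕ) + c + (a + 1)) hn0
      generalize ((r : ℕ) + c + (a + 1)) % n = u at *
      rcases Nat.lt_or_ge (u + 1) n with h | h
      · rw [Nat.mod_eq_of_lt h] at h1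
        rw [if_neg (by omega)]; omega
      · have : u + 1 = n := by omega
        rw [this, Nat.mod_self] at h1
        rw [if_pos h1]; omega
    have key : ∀ e, e < n → ((((r : ℕ) + c + (a + 2 + e)) % n = 0) ↔ (t + e = 0 ∨ t + e = n)) := by
      intro e he
      rw [← aux_mod n t e htn he, ht, Nat.mod_add_mod]
      rw [show (r : ℕ) + c + (a + 2 + e) = (r : ℕ) + c + (a + 2) + e by ring]
    have S1 : (∑ k ∈ Finset.range (a + 2 + b - (a + 2) + 1),
        (Jmat n ^ (a + 2 + b - 1) * (Jmat n)ᵀ ^ k * Kmat n) r c)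
        = if t = 0 ∨ n ≤ t + b then 1 else 0 := by
      have : ∀ k ∈ Finset.range (a + 2 + b - (a + 2) + 1),
          (Jmat n ^ (a + 2 + b - 1) * (Jmat n)ᵀ ^ k * Kmat n) r c
          = if k = (if t = 0 then b else t + b - n) ∧ (t = 0 ∨ n ≤ t + b) then 1 else 0 := by
        intro k hk
        rw [Finset.mem_range] at hk
        rw [aux_J_JT _ _ _ (by omega), aux_JK,
          show a + 2 + b - 1 - k + 1 = a + 2 + (b - k) by omega]
        refine if_congr ?_ rfl rfl
        rw [key _ (by omega)]
        split_ifs <;> omega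
      rw [Finset.sum_congr rfl this]
      by_cases h : t = 0 ∨ n ≤ t + b
      · rw [if_pos h]
        simp only [h, and_true]
        rw [Finset.sum_ite_eq', if_pos]
        rw [Finset.mem_range]
        split_ifs <;> omega
      · simp [h]
    have S2 : (∑ m ∈ Finset.Icc 1 (a + 2 - 1),
        q ^ (2 * m) * (if ((r : ℕ) + c + (a + 2 + b - 1 + m + 1)) % n = 0 then 1 else 0))
        = if t + b < n ∧ n ≤ t + b + a + 1 ∧ t ≠ 0 then q ^ (2 * (n - t - b)) else 0 := by
      have : ∀ m ∈ Finset.Icc 1 (a + 2 - 1),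
          q ^ (2 * m) * (if ((r : ℕ) + c + (a + 2 + b - 1 + m + 1)) % n = 0 then 1 else 0)
          = if m = n - t - b then (if t ≠ 0 then q ^ (2 * m) else 0) else 0 := by
        intro m hm
        rw [Finset.mem_Icc] at hm
        rw [show a + 2 + b - 1 + m + 1 = a + 2 + (b + m) by omega]
        rw [if_congr (key (b + m) (by omega)) rfl rfl]
        split_ifs <;> first | omega | simp
      rw [Finset.sum_congr rfl this, Finset.sum_ite_eq']
      simp only [Finset.mem_Icc]
      split_ifs <;> first | rfl | omega
    rw [S1]
    rw [show a + 2 - 1 = a + 1 from rfl] at *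
    rw [show a + 2 - 2 = a from rfl, show a + 1 + 1 = a + 2 from rfl, ← ht, hu]
    rw [S2]
    clear S1 S2 key hu
    rw [show a + 2 + b - (a + 2) + 1 = b + 1 by omega]
    unfold firstRow
    by_cases h0 : t = 0
    · subst h0
      simp only [if_true, true_or]
      rw [if_pos (by omega), if_neg (by omega), if_neg (by omega), if_neg (by omega),
        if_neg (by omega), show a + 2 + b - (a + 2) + 2 * 0 = b by omega,
        show a + 2 + b - (a + 1) = b + 1 by omega]
      ring
    rw [if_neg h0]
    by_cases h1 : t < a + 2
    · rw [if_pos h1, if_pos (by omega), if_neg (by omega), if_neg (by omega),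
        show a + 2 + b - (a + 2) + 2 * t = b + 2 * t by omega]
      obtain ⟨s, rfl⟩ : ∃ s, t = s + 1 := ⟨t - 1, by omega⟩
      rw [show a + 2 + b - (a + 1) + 2 * (s + 1 - 1) = b + 1 + 2 * s by omega]
      ring
    rw [if_neg h1, if_neg (by omega : ¬ (t - 1 < a + 1))]
    by_cases h2 : t + (a + 2 + b) < n + 1
    · rw [if_pos h2, if_pos (by omega), if_neg (by omega), if_neg (by omega)]
      ring
    rw [if_neg h2]
    by_cases h3 : t + b < n
    · obtain ⟨d, hd⟩ : ∃ d, n = t + b + d := ⟨n - t - b, by omega⟩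
      rw [if_pos (by omega), if_neg (by omega : ¬ (t = 0 ∨ n ≤ t + b)),
        if_pos (by omega : t + b < n ∧ n ≤ t + b + a + 1 ∧ t ≠ 0),
        show n - t - b = d by omega,
        show a + 2 + (a + 2 + b) - 2 * (t + (a + 2 + b) - n) = b + 2 * d by omega]
      by_cases h4 : t + a + b + 1 = n
      · rw [if_pos (by omega)]
        have : d = a + 1 := by omega
        subst this
        ring
      · rw [if_neg (by omega), if_pos (by omega),
          show a + 1 + (a + 2 + b) - 2 * (t - 1 + (a + 2 + b) - n) = b + 1 + 2 * d by omega]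
        ring
    · rw [if_neg (by omega), if_pos (by omega : (t = 0 ∨ n ≤ t + b)),
        if_neg (by omega), if_neg (by omega),
        show a + 2 + b - (a + 2) = b by omega]
      by_cases h4 : t + b = n
      · rw [if_neg (by omega), show a + 2 + b - (a + 1) = b + 1 by omega]
        ring
      · rw [if_neg (by omega), show a + 2 + b - (a + 1) = b + 1 by omega]
        ring
  · intro j h1 hj
    obtain ⟨b, rfl⟩ : ∃ b, j = b + 1 := ⟨j - 1, by omega⟩
    ext1 r c
    have hk := aux_JKC n 0 1 (b + 1) r c
    rw [pow_zero, one_mul] at hk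
    rw [Finset.sum_mul]
    simp only [Matrix.sub_apply, Matrix.smul_apply, Matrix.sum_apply,
      smul_eq_mul, hk, aux_JK, Matrix.of_apply]
    obtain ⟨t, ht⟩ : ∃ t, t = ((r : ℕ) + c + 1) % n := ⟨_, rfl⟩
    have htn : t < n := ht ▸ Nat.mod_lt _ hn0
    have S : (∑ k ∈ Finset.range (b + 1),
        (if ((r : ℕ) + c + (k + 1)) % n = 0 then (1 : Polynomial ℤ) else 0))
        = if t = 0 ∨ n ≤ t + b then 1 else 0 := by
      have : ∀ k ∈ Finset.range (b + 1),
          (if ((r : ℕ) + c + (k + 1)) % n = 0 then (1 : Polynomial ℤ) else 0)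
          = if k = (if t = 0 then 0 else n - t) then 1 else 0 := by
        intro k hk
        rw [Finset.mem_range] at hk
        refine if_congr ?_ rfl rfl
        rw [show (r : ℕ) + c + (k + 1) = (r : ℕ) + c + 1 + k by ring, ← Nat.mod_add_mod, ← ht,
          aux_mod n t k htn (by omega)]
        split_ifs <;> omega
      rw [Finset.sum_congr rfl this, Finset.sum_ite_eq']
      refine if_congr ?_ rfl rfl
      rw [Finset.mem_range]
      split_ifs <;> omega
    rw [S, zero_add, ← ht]
    unfold firstRow
    by_cases h0 : t = 0
    · subst h0
      rw [if_pos (by omega), if_pos (by omega), show b + 1 - 1 + 2 * 0 = b by omega]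
      ring
    rw [if_neg (by omega)]
    by_cases h2 : t + b < n
    · rw [if_pos (by omega), if_neg (by omega)]
      ring
    · rw [if_neg (by omega), if_neg (by omega), if_pos (by omega), show b + 1 - 1 = b by omega]
      ring
end
end
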